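/- arXiv:1910.13871 — 5 statements merged into one kernel-verified Lean document; each statement's English description precedes it below -/
import Mathlib

section
/- For every λ ∈ (0,1) and every m > 0, there exists a unique real J ≥ 1/λ such that m = (D₁ − 1 + 1/λ)·J − D₁²/2 + D₁/2 − D₁/λ + (λ−1)/λ², where D₁ = ⌈J − 1/λ⌉. -/
/-- The function `φ_λ(J) = (D − 1 + 1/λ)·J − D²/2 + D/2 − D/λ + (λ−1)/λ²`
where `D = ⌈J − 1/λ⌉` (right-hand side of equation (13) of the paper). -/
noncomputable def phi (lam J : ℝ) : ℝ :=
  ((⌈J - 1 / lam⌉ : ℝ) - 1 + 1 / lam) * J - (⌈J - 1 / lam⌉ : ℝ) ^ 2 / 2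
    + (⌈J - 1 / lam⌉ : ℝ) / 2 - (⌈J - 1 / lam⌉ : ℝ) / lam + (lam - 1) / lam ^ 2

/-- The affine function of `x` that `phi` coincides with where `⌈J - 1 / lam⌉ = k`,
with `a = 1 / lam` and `x = J - a`. -/
noncomputable def phiPiece (a : ℝ) (k : ℤ) (x : ℝ) : ℝ :=
  ((k : ℝ) - 1 + a) * x - (k : ℝ) * (k - 1) / 2

theorem phi_eq_phiPiece {lam : ℝ} (hlam : lam ≠ 0) (J : ℝ) :
    phi lam J = phiPiece (1 / lam) ⌈J - 1 / lam⌉ (J - 1 / lam) := by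
  unfold phi phiPiece
  field_simp
  ring

theorem phiPiece_le_ceil (a : ℝ) (k : ℤ) (x : ℝ) :
    phiPiece a k x ≤ phiPiece a ⌈x⌉ x := by
  have hle := Int.le_ceil x
  have hlt := Int.ceil_lt_add_one x
  generalize ⌈x⌉ = d at hle hlt ⊢
  have key : phiPiece a d x - phiPiece a k x = ((d : ℝ) - k) * (x - (d + k - 1) / 2) := by
    unfold phiPiece
    ring
  suffices 0 ≤ ((d : ℝ) - k) * (x - (d + k - 1) / 2) by linarith
  rcases lt_trichotomy k d with h | rfl | h
  · have h' : (k : ℝ) + 1 ≤ d := by exact_mod_cast h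
    exact mul_nonneg (by linarith) (by linarith)
  · simp
  · have h' : (d : ℝ) + 1 ≤ k := by exact_mod_cast h
    exact mul_nonneg_of_nonpos_of_nonpos (by linarith) (by linarith)

theorem phi_strictMonoOn {lam : ℝ} (hlam : lam ∈ Set.Ioo (0 : ℝ) 1) :
    StrictMonoOn (phi lam) (Set.Ici (1 / lam)) := by
  intro J hJ K _ hJK
  have ha : 1 < 1 / lam := (one_lt_div hlam.1).2 hlam.2
  rw [phi_eq_phiPiece hlam.1.ne', phi_eq_phiPiece hlam.1.ne']
  refine lt_of_lt_of_le ?_ (phiPiece_le_ceil _ ⌈J - 1 / lam⌉ _)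
  have hd : (0 : ℝ) ≤ ⌈J - 1 / lam⌉ := by
    exact_mod_cast Int.ceil_nonneg (sub_nonneg.2 hJ)
  unfold phiPiece
  gcongr
  linarith

theorem exists_phi_eq {lam : ℝ} (hlam : lam ∈ Set.Ioo (0 : ℝ) 1) {m : ℝ} (hm : 0 < m) :
    ∃ J, 1 / lam ≤ J ∧ m = phi lam J := by
  have ha : 1 < 1 / lam := (one_lt_div hlam.1).2 hlam.2
  simp only [phi_eq_phiPiece hlam.1.ne']
  generalize 1 / lam = a at ha ⊢
  have hex : ∃ n : ℕ, m ≤ (n : ℝ) * (n - 1) / 2 + a * n := by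
    obtain ⟨n, hn⟩ := exists_nat_ge (m + 1)
    exact ⟨n, by nlinarith⟩
  classical
  have hspec := Nat.find_spec hex
  have hmin := fun k => Nat.find_min hex (m := k)
  generalize Nat.find hex = n at hspec hmin
  obtain _ | n := n
  · norm_num at hspec
    linarith
  have hlow := not_le.1 (hmin n n.lt_succ_self)
  push_cast at hspec
  have hn : (0 : ℝ) ≤ n := n.cast_nonneg
  have hpos : 0 < (n : ℝ) + a := by linarith
  have hx : (n : ℝ) < (m + n * (n + 1) / 2) / (n + a) := by
    rw [lt_div_iff₀ hpos]
    linarith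
  have hx' : (m + n * (n + 1) / 2) / (n + a) ≤ (n : ℝ) + 1 := by
    rw [div_le_iff₀ hpos]
    linarith
  have hceil : ⌈(m + n * (n + 1) / 2) / ((n : ℝ) + a)⌉ = (n : ℤ) + 1 := by
    rw [Int.ceil_eq_iff]
    push_cast
    constructor <;> linarith
  refine ⟨a + (m + n * (n + 1) / 2) / (n + a), by linarith, ?_⟩
  rw [add_sub_cancel_left, hceil]
  unfold phiPiece
  push_cast
  field_simp
  ring

/-- For every `λ ∈ (0,1)` and `m > 0` there is a unique `J ≥ 1/λ`
with `m = φ_λ(J)`, where `D₁ = ⌈J − 1/λ⌉`. -/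
theorem stmt_1 (lam : ℝ) (hlam : lam ∈ Set.Ioo (0 : ℝ) 1) (m : ℝ) (hm : 0 < m) :
    ∃! J : ℝ, 1 / lam ≤ J ∧ m = phi lam J := by
  obtain ⟨J, hJ, hmJ⟩ := exists_phi_eq hlam hm
  exact ⟨J, ⟨hJ, hmJ⟩, fun K hK =>
    (phi_strictMonoOn hlam).injOn hK.1 hJ (hK.2.symm.trans hmJ)⟩
end

section
/- Let λ ∈ (0,1), m > 0, let J = J_λ(m), and let D₁ and the thresholds D_a(m) be as defined. Define F₀ : {1,2,…} → ℝ by F₀(a) = (a−1)·J − a(a−1)/2 for 1 ≤ a ≤ D₁ and F₀(a) = (a − J − 1)/λ + m + 1/λ² for a ≥ D₁ (these two formulas agree at a = D₁ because m = φ_λ(J)), and define f : {1,2,…} × ℕ → ℝ by f(a,d) = F₀(a+d) if d < D_a(m) and f(a,d) = m + F₀(a) if d ≥ D_a(m). Then for every a ≥ 1 and d ≥ 0: (i) f(a,d) + J = min(μ₀(a,d), μ₁(a,d)); (ii) μ₀(a,d) ≤ μ₁(a,d) whenever d < D_a(m); and (iii) μ₁(a,d) ≤ μ₀(a,d) whenever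 d ≥ D_a(m). In particular the threshold policy that schedules exactly when d ≥ D_a(m) attains the minimum in the Bellman equation at every state. -/
/-- Thresholds `D_a(m)`: `⌈(1−λ+aλ)J − a + 1 − λa(a−1)/2 − 1/λ⌉` for `1 ≤ a < D₁`
and `⌈λm⌉` for `a ≥ D₁`, where `D₁ = ⌈J − 1/λ⌉` and `J = J_λ(m)`. -/
noncomputable def Dthresh (lam m J : ℝ) (a : ℕ) : ℤ :=
  if (a : ℤ) < ⌈J - 1 / lam⌉ then
    ⌈(1 - lam + (a : ℝ) * lam) * J - (a : ℝ) + 1 - lam * ((a : ℝ) * ((a : ℝ) - 1) / 2) - 1 / lam⌉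
  else ⌈lam * m⌉

/-- `F₀(a) = (a−1)J − a(a−1)/2` for `1 ≤ a ≤ D₁` and
`F₀(a) = (a − J − 1)/λ + m + 1/λ²` for `a ≥ D₁`. -/
noncomputable def F0 (lam m J : ℝ) (a : ℕ) : ℝ :=
  if (a : ℤ) ≤ ⌈J - 1 / lam⌉ then ((a : ℝ) - 1) * J - (a : ℝ) * ((a : ℝ) - 1) / 2
  else ((a : ℝ) - J - 1) / lam + m + 1 / lam ^ 2

/-- `f(a,d) = F₀(a+d)` if `d < D_a(m)`, and `f(a,d) = m + F₀(a)` if `d ≥ D_a(m)`. -/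
noncomputable def fval (lam m J : ℝ) (a d : ℕ) : ℝ :=
  if (d : ℤ) < Dthresh lam m J a then F0 lam m J (a + d) else m + F0 lam m J a

/-- Idle value `μ₀(a,d) = d + a + (1−λ)f(a+1,d) + λf(1,d+a)`. -/
noncomputable def mu0 (lam : ℝ) (f : ℕ → ℕ → ℝ) (a d : ℕ) : ℝ :=
  (d : ℝ) + (a : ℝ) + (1 - lam) * f (a + 1) d + lam * f 1 (d + a)

/-- Schedule value `μ₁(a,d) = a + m + (1−λ)f(a+1,0) + λf(1,a)`. -/
noncomputable def mu1 (lam m : ℝ) (f : ℕ → ℕ → ℝ) (a d : ℕ) : ℝ :=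
  (a : ℝ) + m + (1 - lam) * f (a + 1) 0 + lam * f 1 a

/-- The real number whose ceiling is the threshold `D_a(m)` for `a < D₁`. -/
noncomputable def threshPoly (lam J x : ℝ) : ℝ :=
  (1 - lam + x * lam) * J - x + 1 - lam * (x * (x - 1) / 2) - 1 / lam

lemma threshPoly_one (lam J : ℝ) : threshPoly lam J 1 = J - 1 / lam := by
  unfold threshPoly; ring

lemma intCast_lt_of_add_one_le_ceil {x : ℝ} {n : ℤ} (h : n + 1 ≤ ⌈x⌉) : (n : ℝ) < x :=
  Int.lt_ceil.mp (by omega)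

lemma threshPoly_mono {lam J : ℝ} (h0 : 0 < lam) {a b : ℕ} (hab : a ≤ b)
    (hb : (b : ℤ) ≤ ⌈J - 1 / lam⌉) : threshPoly lam J a ≤ threshPoly lam J b := by
  rcases hab.eq_or_lt with rfl | hlt
  · exact le_rfl
  have hb' : (b : ℝ) - 1 < J - 1 / lam := by
    have := intCast_lt_of_add_one_le_ceil (x := J - 1 / lam) (n := (b : ℤ) - 1) (by omega)
    push_cast at this; exact this
  have hlt' : (a : ℝ) + 1 ≤ b := by exact_mod_cast hlt
  have key : threshPoly lam J b - threshPoly lam J a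
      = lam * (((b : ℝ) - a) * (J - 1 / lam - (a + b - 1) / 2)) := by
    unfold threshPoly; field_simp; ring
  have : 0 ≤ lam * (((b : ℝ) - a) * (J - 1 / lam - (a + b - 1) / 2)) :=
    mul_nonneg h0.le (mul_nonneg (by linarith) (by linarith))
  linarith

lemma mul_phi_eq_threshPoly {lam J : ℝ} (h0 : 0 < lam) :
    lam * phi lam J = threshPoly lam J ⌈J - 1 / lam⌉ := by
  unfold phi threshPoly
  generalize (⌈J - 1 / lam⌉ : ℝ) = D
  field_simp; ring

lemma phi_one_div {lam : ℝ} (h0 : 0 < lam) : phi lam (1 / lam) = 0 := by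
  have : lam ≠ 0 := h0.ne'
  unfold phi
  simp only [sub_self, Int.ceil_zero, Int.cast_zero]
  field_simp; ring

lemma exists_ceil_eq {lam m J : ℝ} (h0 : 0 < lam) (hm : 0 < m) (hJ : 1 / lam ≤ J)
    (hphi : phi lam J = m) : ∃ N : ℕ, 1 ≤ N ∧ ⌈J - 1 / lam⌉ = N := by
  have hlt : 1 / lam < J := by
    refine lt_of_le_of_ne hJ fun h => ?_
    rw [← h, phi_one_div h0] at hphi
    exact hm.ne hphi
  have hpos : 0 < ⌈J - 1 / lam⌉ := Int.ceil_pos.mpr (sub_pos.mpr hlt)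
  exact ⟨⌈J - 1 / lam⌉.toNat, by omega, by omega⟩

/-- The thresholds are the ceilings of `threshPoly`, frozen at `D₁`. -/
lemma Dthresh_eq {lam m J : ℝ} (h0 : 0 < lam) (hphi : phi lam J = m) {N : ℕ}
    (hN : ⌈J - 1 / lam⌉ = N) (a : ℕ) :
    Dthresh lam m J a = ⌈threshPoly lam J ((min a N : ℕ) : ℝ)⌉ := by
  unfold Dthresh
  split_ifs with h
  · rw [min_eq_left (by omega)]; rfl
  · rw [min_eq_right (by omega), ← hphi, mul_phi_eq_threshPoly h0, hN, Int.cast_natCast]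

lemma F0_of_le {lam m J : ℝ} {N a : ℕ} (hN : ⌈J - 1 / lam⌉ = N) (h : a ≤ N) :
    F0 lam m J a = ((a : ℝ) - 1) * J - (a : ℝ) * ((a : ℝ) - 1) / 2 :=
  if_pos (by omega)

lemma F0_of_ge {lam m J : ℝ} (h0 : 0 < lam) (hphi : phi lam J = m) {N a : ℕ}
    (hN : ⌈J - 1 / lam⌉ = N) (h : N ≤ a) :
    F0 lam m J a = ((a : ℝ) - J - 1) / lam + m + 1 / lam ^ 2 := by
  rcases h.eq_or_lt with rfl | h
  · rw [F0_of_le hN le_rfl, ← hphi]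
    unfold phi
    rw [hN, Int.cast_natCast]
    field_simp; ring
  · exact if_neg (by omega)

/-- Below `D₁`, the quadratic branch of `F₀` lies under the linear one. -/
lemma F0_le {lam m J : ℝ} (h0 : 0 < lam) (hphi : phi lam J = m) {N : ℕ}
    (hN : ⌈J - 1 / lam⌉ = N) (a : ℕ) :
    F0 lam m J a ≤ ((a : ℝ) - J - 1) / lam + m + 1 / lam ^ 2 := by
  rcases le_or_gt N a with h | h
  · exact (F0_of_ge h0 hphi hN h).le
  have e1 := F0_of_ge h0 hphi hN le_rfl
  rw [F0_of_le hN le_rfl] at e1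
  rw [F0_of_le hN h.le]
  have hb : (N : ℝ) - 1 < J - 1 / lam := by
    have := intCast_lt_of_add_one_le_ceil (x := J - 1 / lam) (n := (N : ℤ) - 1) (by omega)
    push_cast at this; exact this
  have h' : (a : ℝ) + 1 ≤ N := by exact_mod_cast h
  have := mul_nonneg (show 0 ≤ (N : ℝ) - a by linarith)
    (show 0 ≤ J - 1 / lam - (N + a - 1) / 2 by linarith)
  have e2 : ((N : ℝ) - J - 1) / lam = ((a : ℝ) - J - 1) / lam + (N - a) * (1 / lam) := by ring
  nlinarith

lemma threshPoly_one_le {lam J : ℝ} (h0 : 0 < lam) {N a : ℕ} (h1 : 1 ≤ N)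
    (hN : ⌈J - 1 / lam⌉ = N) (ha : 1 ≤ a) :
    J - 1 / lam ≤ threshPoly lam J ((min a N : ℕ) : ℝ) := by
  have := threshPoly_mono (J := J) h0 (a := 1) (b := min a N) (by omega) (by omega)
  rwa [Nat.cast_one, threshPoly_one] at this

lemma le_Dthresh {lam m J : ℝ} (h0 : 0 < lam) (hphi : phi lam J = m) {N a : ℕ} (h1 : 1 ≤ N)
    (hN : ⌈J - 1 / lam⌉ = N) (ha : 1 ≤ a) : (N : ℤ) ≤ Dthresh lam m J a := by
  rw [Dthresh_eq h0 hphi hN, ← hN]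
  exact Int.ceil_mono (threshPoly_one_le h0 h1 hN ha)

lemma Dthresh_one {lam m J : ℝ} (h0 : 0 < lam) (hphi : phi lam J = m) {N : ℕ} (h1 : 1 ≤ N)
    (hN : ⌈J - 1 / lam⌉ = N) : Dthresh lam m J 1 = N := by
  rw [Dthresh_eq h0 hphi hN, min_eq_left h1, Nat.cast_one, threshPoly_one, hN]

lemma Dthresh_le_succ {lam m J : ℝ} (h0 : 0 < lam) (hphi : phi lam J = m) {N : ℕ}
    (hN : ⌈J - 1 / lam⌉ = N) (a : ℕ) : Dthresh lam m J a ≤ Dthresh lam m J (a + 1) := by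
  rw [Dthresh_eq h0 hphi hN, Dthresh_eq h0 hphi hN]
  exact Int.ceil_mono (threshPoly_mono h0 (by omega) (by omega))

lemma fval_one_of_lt {lam m J : ℝ} (h0 : 0 < lam) (hphi : phi lam J = m) {N x : ℕ} (h1 : 1 ≤ N)
    (hN : ⌈J - 1 / lam⌉ = N) (hx : x < N) : fval lam m J 1 x = F0 lam m J (x + 1) := by
  unfold fval
  rw [Dthresh_one h0 hphi h1 hN, if_pos (by omega), add_comm]

lemma fval_one_of_ge {lam m J : ℝ} (h0 : 0 < lam) (hphi : phi lam J = m) {N x : ℕ} (h1 : 1 ≤ N)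
    (hN : ⌈J - 1 / lam⌉ = N) (hx : N ≤ x) : fval lam m J 1 x = m := by
  unfold fval
  rw [Dthresh_one h0 hphi h1 hN, if_neg (by omega), F0_of_le hN h1]
  simp

/-- The recursion satisfied by `F₀`: the Bellman equation of idling at `d = 0`. -/
lemma F0_add {lam m J : ℝ} (h0 : 0 < lam) (hphi : phi lam J = m) {N : ℕ} (h1 : 1 ≤ N)
    (hN : ⌈J - 1 / lam⌉ = N) (a : ℕ) :
    F0 lam m J a + J = a + (1 - lam) * F0 lam m J (a + 1) + lam * fval lam m J 1 a := by
  rcases lt_or_ge a N with h | h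
  · rw [fval_one_of_lt h0 hphi h1 hN h, F0_of_le hN h.le, F0_of_le hN h]
    push_cast; ring
  · rw [fval_one_of_ge h0 hphi h1 hN h, F0_of_ge h0 hphi hN h, F0_of_ge h0 hphi hN (by omega)]
    push_cast; field_simp; ring

lemma mu1_fval {lam m J : ℝ} (h0 : 0 < lam) (hphi : phi lam J = m) {N : ℕ} (h1 : 1 ≤ N)
    (hN : ⌈J - 1 / lam⌉ = N) (a d : ℕ) :
    mu1 lam m (fval lam m J) a d = m + F0 lam m J a + J := by
  have hf : fval lam m J (a + 1) 0 = F0 lam m J (a + 1) := by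
    have := le_Dthresh h0 hphi h1 hN (Nat.le_add_left 1 a)
    exact if_pos (by omega)
  unfold mu1
  rw [hf, add_assoc m, F0_add h0 hphi h1 hN]
  ring

lemma mu0_fval_of_lt {lam m J : ℝ} (h0 : 0 < lam) (hphi : phi lam J = m) {N a d : ℕ}
    (h1 : 1 ≤ N) (hN : ⌈J - 1 / lam⌉ = N) (h : (d : ℤ) < Dthresh lam m J (a + 1)) :
    mu0 lam (fval lam m J) a d = F0 lam m J (a + d) + J := by
  have hf : fval lam m J (a + 1) d = F0 lam m J (a + d + 1) := by
    unfold fval; rw [if_pos h, add_right_comm]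
  unfold mu0
  rw [hf, F0_add h0 hphi h1 hN, add_comm d a]
  push_cast; ring

/-- The linear branch of `F₀` compared with `m + F₀(a)`. -/
lemma linear_sub_F0 {lam m J : ℝ} (h0 : 0 < lam) (hphi : phi lam J = m) {N : ℕ}
    (hN : ⌈J - 1 / lam⌉ = N) (a d : ℕ) :
    (((a + d : ℕ) : ℝ) - J - 1) / lam + m + 1 / lam ^ 2 - (m + F0 lam m J a)
      = (d - threshPoly lam J ((min a N : ℕ) : ℝ)) / lam := by
  rcases le_or_gt a N with h | h
  · rw [min_eq_left h, F0_of_le hN h]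
    unfold threshPoly
    push_cast; field_simp; ring
  · have e := mul_phi_eq_threshPoly (J := J) h0
    rw [hN, Int.cast_natCast, hphi] at e
    rw [min_eq_right h.le, F0_of_ge h0 hphi hN h.le, ← e]
    push_cast; field_simp; ring

lemma F0_add_le_of_lt {lam m J : ℝ} (h0 : 0 < lam) (hphi : phi lam J = m) {N a d : ℕ}
    (hN : ⌈J - 1 / lam⌉ = N) (h : (d : ℤ) < Dthresh lam m J a) :
    F0 lam m J (a + d) ≤ m + F0 lam m J a := by
  rw [Dthresh_eq h0 hphi hN, Int.lt_ceil, Int.cast_natCast] at h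
  have := F0_le h0 hphi hN (a + d)
  have := linear_sub_F0 h0 hphi hN a d
  have := div_nonpos_of_nonpos_of_nonneg (sub_nonpos.mpr h.le) h0.le
  linarith

lemma le_F0_add_of_ge {lam m J : ℝ} (h0 : 0 < lam) (hphi : phi lam J = m) {N a d : ℕ}
    (h1 : 1 ≤ N) (hN : ⌈J - 1 / lam⌉ = N) (ha : 1 ≤ a) (h : Dthresh lam m J a ≤ d) :
    m + F0 lam m J a ≤ F0 lam m J (a + d) := by
  have hd := (le_Dthresh h0 hphi h1 hN ha).trans h
  rw [Dthresh_eq h0 hphi hN, Int.ceil_le, Int.cast_natCast] at h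
  rw [F0_of_ge h0 hphi hN (a := a + d) (by omega)]
  have := linear_sub_F0 h0 hphi hN a d
  have := div_nonneg (sub_nonneg.mpr h) h0.le
  linarith

lemma mul_fval_one_le {lam m J : ℝ} (h0 : 0 < lam) (hphi : phi lam J = m) {N a d : ℕ}
    (h1 : 1 ≤ N) (hN : ⌈J - 1 / lam⌉ = N) (h : Dthresh lam m J (a + 1) ≤ d) :
    lam * fval lam m J 1 a ≤ d := by
  rw [Dthresh_eq h0 hphi hN, Int.ceil_le, Int.cast_natCast] at h
  refine le_trans ?_ h
  rcases lt_or_ge a N with ha | ha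
  · have := intCast_lt_of_add_one_le_ceil (x := J - 1 / lam) (n := (a : ℤ)) (by omega)
    rw [Int.cast_natCast] at this
    rw [fval_one_of_lt h0 hphi h1 hN ha, F0_of_le hN ha, min_eq_left (by omega)]
    unfold threshPoly
    push_cast
    nlinarith
  · have e := mul_phi_eq_threshPoly (J := J) h0
    rw [hN, Int.cast_natCast, hphi] at e
    rw [fval_one_of_ge h0 hphi h1 hN ha, min_eq_right (by omega), e]

lemma mu1_le_mu0_of_ge {lam m J : ℝ} (h0 : 0 < lam) (hphi : phi lam J = m) {N a d : ℕ}
    (h1 : 1 ≤ N) (hN : ⌈J - 1 / lam⌉ = N) (ha : 1 ≤ a) (h : Dthresh lam m J a ≤ d) :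
    mu1 lam m (fval lam m J) a d ≤ mu0 lam (fval lam m J) a d := by
  rw [mu1_fval h0 hphi h1 hN]
  rcases lt_or_ge (d : ℤ) (Dthresh lam m J (a + 1)) with h2 | h2
  · rw [mu0_fval_of_lt h0 hphi h1 hN h2]
    linarith [le_F0_add_of_ge h0 hphi h1 hN ha h]
  · have hd := (le_Dthresh h0 hphi h1 hN ha).trans h
    have hf : fval lam m J (a + 1) d = m + F0 lam m J (a + 1) := if_neg (by omega)
    unfold mu0
    rw [hf, fval_one_of_ge h0 hphi h1 hN (x := d + a) (by omega)]
    linarith [mul_fval_one_le h0 hphi h1 hN h2, F0_add h0 hphi h1 hN a]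

/-- `f` solves the Bellman equation, idling is optimal below the threshold,
scheduling is optimal at or above the threshold; in particular the threshold
policy that schedules exactly when `d ≥ D_a(m)` attains the minimum in the
Bellman equation at every state. -/
theorem stmt_2 (lam m J : ℝ) (hlam : lam ∈ Set.Ioo (0 : ℝ) 1) (hm : 0 < m)
    (hJ : 1 / lam ≤ J) (hphi : phi lam J = m) :
    ∀ a d : ℕ, 1 ≤ a →
      (fval lam m J a d + J =
        min (mu0 lam (fval lam m J) a d) (mu1 lam m (fval lam m J) a d)) ∧
      ((d : ℤ) < Dthresh lam m J a →
        mu0 lam (fval lam m J) a d ≤ mu1 lam m (fval lam m J) a d) ∧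
      (Dthresh lam m J a ≤ (d : ℤ) →
        mu1 lam m (fval lam m J) a d ≤ mu0 lam (fval lam m J) a d) := by
  obtain ⟨h0, -⟩ := hlam
  obtain ⟨N, h1, hN⟩ := exists_ceil_eq h0 hm hJ hphi
  intro a d ha
  have hlow : (d : ℤ) < Dthresh lam m J a →
      mu0 lam (fval lam m J) a d = F0 lam m J (a + d) + J ∧
        mu0 lam (fval lam m J) a d ≤ mu1 lam m (fval lam m J) a d := fun h => by
    have e := mu0_fval_of_lt h0 hphi h1 hN (h.trans_le (Dthresh_le_succ h0 hphi hN a))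
    refine ⟨e, ?_⟩
    rw [e, mu1_fval h0 hphi h1 hN]
    linarith [F0_add_le_of_lt h0 hphi hN h]
  refine ⟨?_, fun h => (hlow h).2, mu1_le_mu0_of_ge h0 hphi h1 hN ha⟩
  rcases lt_or_ge (d : ℤ) (Dthresh lam m J a) with h | h
  · rw [min_eq_left (hlow h).2, (hlow h).1, fval, if_pos h]
  · rw [min_eq_right (mu1_le_mu0_of_ge h0 hphi h1 hN ha h), mu1_fval h0 hphi h1 hN, fval,
      if_neg h.not_gt]
end

section
/- Let λ ∈ [0,1], m ∈ ℝ, and let f : {1,2,…} × ℕ → ℝ be nondecreasing in its second argument (i.e., f(a,d) ≤ f(a,d′) whenever d ≤ d′). Then for every a ≥ 1 and every integer d with d ≥ m, the schedule value is no larger than the idle value: μ₁(a,d) ≤ μ₀(a,d). Consequently, if idling is strictly better than scheduling at state (a,d), i.e. μ₀(a,d) < μ₁(a,d), then d < m. -/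
/-- If `f` is nondecreasing in its second argument, then for every `a ≥ 1`
and every `d ≥ m` the schedule value is no larger than the idle value,
and consequently if idling is strictly better then `d < m`. -/
theorem stmt_3 (lam m : ℝ) (hlam : lam ∈ Set.Icc (0 : ℝ) 1) (f : ℕ → ℕ → ℝ)
    (hmono : ∀ a d d' : ℕ, 1 ≤ a → d ≤ d' → f a d ≤ f a d') :
    ∀ a d : ℕ, 1 ≤ a →
      (m ≤ (d : ℝ) → mu1 lam m f a d ≤ mu0 lam f a d) ∧
      (mu0 lam f a d < mu1 lam m f a d → (d : ℝ) < m) := by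
  intro a d _
  have key : m ≤ (d : ℝ) → mu1 lam m f a d ≤ mu0 lam f a d := by
    intro hd
    have h_idle := mul_le_mul_of_nonneg_left
      (hmono (a + 1) 0 d (Nat.le_add_left 1 a) d.zero_le) (sub_nonneg.2 hlam.2)
    have h_arrival := mul_le_mul_of_nonneg_left
      (hmono 1 a (d + a) le_rfl (Nat.le_add_left a d)) hlam.1
    unfold mu0 mu1
    linarith
  exact ⟨key, fun h => lt_of_not_ge fun hd => h.not_ge (key hd)⟩
end

section
/- Let λ ∈ (0,1] and fix an integer a ≥ 1. Then the Whittle index I(a,d) is nondecreasing in d: for all integers 0 ≤ d₁ ≤ d₂, I(a,d₁) ≤ I(a,d₂). -/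
/-- The Whittle index of Theorem 3 of the paper (unit weight ω = 1):
`I(a,d) = x²/2 + (1/λ − 1/2)x` with `x = (d + λa(a−1)/2)/(1 − λ + aλ)` if
`d > λa²/2 + (1 − λ/2)a`, and `I(a,d) = d/λ` otherwise. -/
noncomputable def WIndex (lam : ℝ) (a d : ℕ) : ℝ :=
  if lam * (a : ℝ) ^ 2 / 2 + (1 - lam / 2) * (a : ℝ) < (d : ℝ) then
    (((d : ℝ) + lam * (a : ℝ) * ((a : ℝ) - 1) / 2) / (1 - lam + (a : ℝ) * lam)) ^ 2 / 2
      + (1 / lam - 1 / 2) *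
        (((d : ℝ) + lam * (a : ℝ) * ((a : ℝ) - 1) / 2) / (1 - lam + (a : ℝ) * lam))
  else (d : ℝ) / lam

/-- The quadratic branch of the index is monotone on nonnegative arguments. -/
theorem quadratic_branch_mono {lam x y : ℝ} (hpos : 0 < lam) (hle : lam ≤ 1) (hx : 0 ≤ x)
    (hxy : x ≤ y) :
    x ^ 2 / 2 + (1 / lam - 1 / 2) * x ≤ y ^ 2 / 2 + (1 / lam - 1 / 2) * y := by
  have hc : 0 ≤ 1 / lam - 1 / 2 := by linarith [(one_le_div hpos).2 hle]
  gcongr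

/-- The Whittle index `I(a,d)` is nondecreasing in `d`. -/
theorem stmt_11 (lam : ℝ) (hlam : lam ∈ Set.Ioc (0 : ℝ) 1)
    (a : ℕ) (ha : 1 ≤ a) :
    ∀ d₁ d₂ : ℕ, d₁ ≤ d₂ → WIndex lam a d₁ ≤ WIndex lam a d₂ := by
  obtain ⟨hpos, hle⟩ := hlam
  intro d₁ d₂ hd
  have ha' : (1 : ℝ) ≤ a := by exact_mod_cast ha
  have hd' : (d₁ : ℝ) ≤ d₂ := by exact_mod_cast hd
  have hden : 0 < 1 - lam + (a : ℝ) * lam := by nlinarith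
  have hnum : 0 ≤ lam * (a : ℝ) * ((a : ℝ) - 1) / 2 := by
    have : 0 ≤ (a : ℝ) - 1 := by linarith
    positivity
  unfold WIndex
  split_ifs with h₁ h₂ h₂
  · exact quadratic_branch_mono hpos hle (by positivity) (by gcongr)
  · exact absurd (h₁.trans_le hd') h₂
  · have hx : (a : ℝ) ≤
        ((d₂ : ℝ) + lam * (a : ℝ) * ((a : ℝ) - 1) / 2) / (1 - lam + (a : ℝ) * lam) := by
      rw [le_div_iff₀ hden]
      linarith
    refine le_trans ?_ (quadratic_branch_mono hpos hle (by positivity) hx)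
    calc (d₁ : ℝ) / lam
        ≤ (lam * (a : ℝ) ^ 2 / 2 + (1 - lam / 2) * (a : ℝ)) / lam := by
          gcongr
          exact not_lt.1 h₁
      _ = (a : ℝ) ^ 2 / 2 + (1 / lam - 1 / 2) * (a : ℝ) := by
          field_simp
  · gcongr
end

section
/- Let λ ∈ (0,1) and let Γ ≥ 1 be an integer. The function F is nondecreasing on ℕ, satisfies 0 ≤ F(x) ≤ 1 for all x ∈ ℕ, and F(x) → 1 as x → ∞; hence F is the cumulative distribution function of a probability distribution on the positive integers. -/
open Filter

/-- The stationary AoI cumulative distribution function of Theorem 4 of the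
paper: `F(0) = 0`, `F(x) = (x − ((1−λ)/λ)(1 − (1−λ)^x))/Γ` for `1 ≤ x ≤ Γ`,
and `F(x) = 1 − (1−λ)^{x−Γ+1}(1 − (1−λ)^Γ)/(λΓ)` for `x ≥ Γ+1`. -/
noncomputable def Fcdf (lam : ℝ) (Γ : ℕ) (x : ℕ) : ℝ :=
  if x = 0 then 0
  else if x ≤ Γ then ((x : ℝ) - ((1 - lam) / lam) * (1 - (1 - lam) ^ x)) / (Γ : ℝ)
  else 1 - (1 - lam) ^ (x - Γ + 1) * (1 - (1 - lam) ^ Γ) / (lam * (Γ : ℝ))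

theorem Fcdf_of_le (lam : ℝ) {Γ x : ℕ} (hx : x ≤ Γ) :
    Fcdf lam Γ x = ((x : ℝ) - ((1 - lam) / lam) * (1 - (1 - lam) ^ x)) / (Γ : ℝ) := by
  rcases eq_or_ne x 0 with rfl | h0
  · simp [Fcdf]
  · simp [Fcdf, h0, hx]

theorem Fcdf_of_ge {lam : ℝ} (hlam : lam ≠ 0) {Γ x : ℕ} (hΓ : 1 ≤ Γ) (hx : Γ ≤ x) :
    Fcdf lam Γ x = 1 - (1 - lam) ^ (x - Γ + 1) * (1 - (1 - lam) ^ Γ) / (lam * (Γ : ℝ)) := by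
  rcases hx.eq_or_lt with rfl | hlt
  · have hΓ' : (Γ : ℝ) ≠ 0 := by positivity
    rw [Fcdf_of_le lam le_rfl, Nat.sub_self]
    field_simp
    ring
  · rw [Fcdf, if_neg (by lia), if_neg (by lia)]

theorem Fcdf_monotone {lam : ℝ} (hlam : lam ∈ Set.Ioo (0 : ℝ) 1) {Γ : ℕ} (hΓ : 1 ≤ Γ) :
    Monotone (Fcdf lam Γ) := by
  obtain ⟨h0, h1⟩ := hlam
  have hq0 : 0 ≤ 1 - lam := by linarith
  have hq1 : 1 - lam ≤ 1 := by linarith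
  refine monotone_nat_of_le_succ fun x => ?_
  rcases Nat.lt_or_ge x Γ with hx | hx
  · rw [Fcdf_of_le lam hx.le, Fcdf_of_le lam hx]
    rw [Nat.succ_eq_add_one]
    gcongr ?_ / _
    have hstep : (1 - lam) / lam * (1 - (1 - lam) ^ (x + 1)) =
        (1 - lam) / lam * (1 - (1 - lam) ^ x) + (1 - lam) ^ (x + 1) := by
      field_simp
      ring
    have hpow : (1 - lam) ^ (x + 1) ≤ 1 := pow_le_one₀ hq0 hq1
    push_cast
    linarith
  · rw [Fcdf_of_ge h0.ne' hΓ hx, Fcdf_of_ge h0.ne' hΓ (hx.trans x.le_succ)]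
    have hpow : (1 - lam) ^ (x + 1 - Γ + 1) ≤ (1 - lam) ^ (x - Γ + 1) :=
      pow_le_pow_of_le_one hq0 hq1 (by lia)
    have hΓpow : 0 ≤ 1 - (1 - lam) ^ Γ := sub_nonneg.2 (pow_le_one₀ hq0 hq1)
    gcongr

theorem tendsto_Fcdf {lam : ℝ} (hlam : lam ∈ Set.Ioo (0 : ℝ) 1) {Γ : ℕ} (hΓ : 1 ≤ Γ) :
    Tendsto (Fcdf lam Γ) atTop (nhds 1) := by
  obtain ⟨h0, h1⟩ := hlam
  have hpow : Tendsto (fun n : ℕ => (1 - lam) ^ n) atTop (nhds 0) :=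
    tendsto_pow_atTop_nhds_zero_of_lt_one (by linarith) (by linarith)
  have hexp : Tendsto (fun x : ℕ => x - Γ + 1) atTop atTop :=
    (tendsto_add_atTop_nat 1).comp (tendsto_sub_atTop_nat Γ)
  have hlim := (((hpow.comp hexp).mul_const (1 - (1 - lam) ^ Γ)).div_const
    (lam * (Γ : ℝ))).const_sub 1
  rw [zero_mul, zero_div, sub_zero] at hlim
  refine hlim.congr' ?_
  filter_upwards [eventually_ge_atTop Γ] with x hx
  exact (Fcdf_of_ge h0.ne' hΓ hx).symm

/-- `F` is nondecreasing, takes values in `[0,1]`, and tends to `1`; hence it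
is the cumulative distribution function of a probability distribution on the
positive integers. -/
theorem stmt_13 (lam : ℝ) (hlam : lam ∈ Set.Ioo (0 : ℝ) 1)
    (Γ : ℕ) (hΓ : 1 ≤ Γ) :
    Monotone (Fcdf lam Γ) ∧
    (∀ x : ℕ, 0 ≤ Fcdf lam Γ x ∧ Fcdf lam Γ x ≤ 1) ∧
    Tendsto (Fcdf lam Γ) atTop (nhds 1) := by
  have hmono := Fcdf_monotone hlam hΓ
  have hlim := tendsto_Fcdf hlam hΓ
  refine ⟨hmono, fun x => ⟨?_, hmono.ge_of_tendsto hlim x⟩, hlim⟩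
  simpa [Fcdf] using hmono x.zero_le
end
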